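/- arXiv:2206.04613 — 5 statements merged into one kernel-verified Lean document; each statement's English description precedes it below -/
import Mathlib

section
/- Let X ∈ ℝ^{n×d}, y ∈ ℝ^n, and consider the diagonal-network model Φ(w₁,w₂) = X(w₁ ∘ w₁ − w₂ ∘ w₂) for w₁, w₂ ∈ ℝ^d (∘ denotes entrywise product), with square loss L(φ) = (1/2n)‖y − φ‖₂². Then the effective regularized risk satisfies, for every (w₁,w₂) and σ > 0: R_σ^{eff}(w₁,w₂) = (1/2n)‖y − X(w₁ ∘ w₁ − w₂ ∘ w₂)‖₂² + 2σ² Σ_{k=1}^d ((XᵀX)_{kk}/n)((w₁)_k² + (w₂)_k²). -/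
open Matrix

theorem loss_hess_aux (n : ℕ) (c : ℝ) (y : Fin n → ℝ) (p v : Fin n → ℝ) :
    iteratedFDeriv ℝ 2 (fun φ : Fin n → ℝ => c * ∑ i, (y i - φ i) ^ 2) p ![v, v]
      = 2 * c * ∑ i, v i ^ 2 := by
  have hproj : ∀ (q : Fin n → ℝ) (i : Fin n), HasFDerivAt (fun φ : Fin n → ℝ => φ i)
      (ContinuousLinearMap.proj (R := ℝ) (φ := fun _ : Fin n => ℝ) i) q :=
    fun q i => (ContinuousLinearMap.proj (R := ℝ) (φ := fun _ : Fin n => ℝ) i).hasFDerivAt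
  have h1 : fderiv ℝ (fun φ : Fin n → ℝ => c * ∑ i, (y i - φ i) ^ 2) =
      fun q => ∑ i, (2 * c * (q i - y i)) •
        (ContinuousLinearMap.proj (R := ℝ) (φ := fun _ : Fin n => ℝ) i) := by
    funext q
    have := (HasFDerivAt.fun_sum (u := Finset.univ)
      (fun i _ => (((hproj q i).const_sub (y i)).pow 2))).const_mul c
    rw [this.fderiv]
    ext u
    simp [Finset.mul_sum]
    rw [← Finset.sum_neg_distrib]
    refine Finset.sum_congr rfl fun i _ => ?_
    ring
  rw [iteratedFDeriv_two_apply, h1]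
  have h2 := HasFDerivAt.fun_sum (u := Finset.univ)
      (fun i _ => ((((hproj p i).sub_const (y i)).const_mul (2 * c)).smul_const
        (ContinuousLinearMap.proj (R := ℝ) (φ := fun _ : Fin n => ℝ) i)))
  rw [h2.fderiv]
  simp [Finset.mul_sum]
  refine Finset.sum_congr rfl fun i _ => ?_
  ring

theorem model_fderiv_aux (n d : ℕ) (X : Matrix (Fin n) (Fin d) ℝ)
    (w v : (Fin d → ℝ) × (Fin d → ℝ)) (i : Fin n) :
    fderiv ℝ (fun w : (Fin d → ℝ) × (Fin d → ℝ) =>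
      X.mulVec fun k => w.1 k * w.1 k - w.2 k * w.2 k) w v i
      = ∑ k, X i k * (2 * w.1 k * v.1 k - 2 * w.2 k * v.2 k) := by
  have ha : ∀ k : Fin d, HasFDerivAt (fun w : (Fin d → ℝ) × (Fin d → ℝ) => w.1 k)
      ((ContinuousLinearMap.proj (R := ℝ) (φ := fun _ : Fin d => ℝ) k).comp
        (ContinuousLinearMap.fst ℝ (Fin d → ℝ) (Fin d → ℝ))) w :=
    fun k => ((ContinuousLinearMap.proj (R := ℝ) (φ := fun _ : Fin d => ℝ) k).comp
        (ContinuousLinearMap.fst ℝ (Fin d → ℝ) (Fin d → ℝ))).hasFDerivAt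
  have hb : ∀ k : Fin d, HasFDerivAt (fun w : (Fin d → ℝ) × (Fin d → ℝ) => w.2 k)
      ((ContinuousLinearMap.proj (R := ℝ) (φ := fun _ : Fin d => ℝ) k).comp
        (ContinuousLinearMap.snd ℝ (Fin d → ℝ) (Fin d → ℝ))) w :=
    fun k => ((ContinuousLinearMap.proj (R := ℝ) (φ := fun _ : Fin d => ℝ) k).comp
        (ContinuousLinearMap.snd ℝ (Fin d → ℝ) (Fin d → ℝ))).hasFDerivAt
  have h := hasFDerivAt_pi.2 (fun i : Fin n => HasFDerivAt.fun_sum (u := Finset.univ)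
    (fun k _ => ((((ha k).mul (ha k)).sub ((hb k).mul (hb k))).const_mul (X i k))))
  have h' : HasFDerivAt (fun w : (Fin d → ℝ) × (Fin d → ℝ) =>
      X.mulVec fun k => w.1 k * w.1 k - w.2 k * w.2 k) _ w := h
  rw [h'.fderiv]
  simp
  refine Finset.sum_congr rfl fun k _ => ?_
  ring

/-- For the diagonal-network model `Φ(w₁,w₂) = X(w₁∘w₁ - w₂∘w₂)` with square loss
`L(φ) = (1/2n)‖y - φ‖²`, the effective regularized risk
`R_σ^eff(w) = L(Φ(w)) + (σ²/2) D²L(Φ(w))[DΦ(w)DΦ(w)ᵀ]` (the regularizer written as the sum,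
over all coordinate directions `e` of the parameter space, of `D²L(Φ(w))[DΦ(w)e, DΦ(w)e]`)
equals the Lasso-type objective
`(1/2n)‖y - X(w₁∘w₁-w₂∘w₂)‖² + 2σ² ∑_k ((XᵀX)_{kk}/n)((w₁)_k² + (w₂)_k²)`. -/
theorem diagonal_network_effective_risk
    (n d : ℕ) (hn : 0 < n)
    (X : Matrix (Fin n) (Fin d) ℝ) (y : Fin n → ℝ)
    (L : (Fin n → ℝ) → ℝ)
    (hL : L = fun φ => (1 / (2 * (n : ℝ))) * ∑ i, (y i - φ i) ^ 2)
    (Φ : ((Fin d → ℝ) × (Fin d → ℝ)) → (Fin n → ℝ))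
    (hΦ : Φ = fun w => X.mulVec fun k => w.1 k * w.1 k - w.2 k * w.2 k)
    (σ : ℝ) (w : (Fin d → ℝ) × (Fin d → ℝ)) :
    L (Φ w) + σ ^ 2 / 2 *
      ((∑ k : Fin d, iteratedFDeriv ℝ 2 L (Φ w)
          ![fderiv ℝ Φ w ((Pi.single k (1 : ℝ) : Fin d → ℝ), (0 : Fin d → ℝ)),
            fderiv ℝ Φ w ((Pi.single k (1 : ℝ) : Fin d → ℝ), (0 : Fin d → ℝ))]) +
        ∑ k : Fin d, iteratedFDeriv ℝ 2 L (Φ w)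
          ![fderiv ℝ Φ w ((0 : Fin d → ℝ), (Pi.single k (1 : ℝ) : Fin d → ℝ)),
            fderiv ℝ Φ w ((0 : Fin d → ℝ), (Pi.single k (1 : ℝ) : Fin d → ℝ))])
    = (1 / (2 * (n : ℝ))) *
        (∑ i, (y i - (X.mulVec fun k => w.1 k * w.1 k - w.2 k * w.2 k) i) ^ 2)
      + 2 * σ ^ 2 * ∑ k, ((Xᵀ * X) k k / (n : ℝ)) * ((w.1 k) ^ 2 + (w.2 k) ^ 2) := by
  have hn' : (n : ℝ) ≠ 0 := by positivity
  subst hL hΦ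
  simp only [loss_hess_aux, model_fderiv_aux]
  congr 1
  rw [← Finset.sum_add_distrib, Finset.mul_sum, Finset.mul_sum]
  refine Finset.sum_congr rfl fun k _ => ?_
  simp only [Pi.single_apply, Pi.zero_apply, mul_ite, mul_one, mul_zero, sub_zero, zero_sub,
    Finset.sum_ite_eq', Finset.mem_univ, if_true, Matrix.mul_apply, Matrix.transpose_apply]
  have e1 : ∀ i, (∑ x, X i x * -(if x = k then 2 * w.2 x else 0)) = -(X i k * (2 * w.2 k)) := by
    intro i
    simp
  simp only [e1]
  rw [Finset.mul_sum, Finset.mul_sum, ← Finset.sum_add_distrib, Finset.mul_sum, Finset.sum_div,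
    Finset.sum_mul, Finset.mul_sum]
  refine Finset.sum_congr rfl fun i _ => ?_
  field_simp
end

section
/- Let X ∈ ℝ^{n×d₀}, W₁ ∈ ℝ^{d₁×d₀}, W₂ ∈ ℝ^{d₂×d₁}, and define Φ(W₁,W₂) = W₂W₁Xᵀ ∈ ℝ^{d₂×n}. Then the sum over all coordinate directions of the squared Frobenius norm of the directional derivative of Φ, i.e. Σ_{i,j} ‖∂Φ/∂(W₁)_{ij}‖_F² + Σ_{i,j} ‖∂Φ/∂(W₂)_{ij}‖_F², equals d₂‖W₁Xᵀ‖_F² + ‖W₂‖_F² ‖X‖_F². Consequently, for the square loss L(φ) = (1/2n)‖Yᵀ − φ‖_F² with Y ∈ ℝ^{n×d₂}, the effective regularized risk is R_σ^{eff}(W₁,W₂) = (1/2n)‖Yᵀ − W₂W₁Xᵀ‖_F² + (σ²/2n)[d₂‖W₁Xᵀ‖_F² + ‖W₂‖_F²‖X‖_F²]. -/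
open Matrix

/-- Squared Frobenius norm of a matrix. -/
def frobSq {a b : ℕ} (A : Matrix (Fin a) (Fin b) ℝ) : ℝ := ∑ i, ∑ j, (A i j) ^ 2

lemma frob_aux_fderiv {n d₀ d₁ d₂ : ℕ} (X : Matrix (Fin n) (Fin d₀) ℝ)
    (W V : (Fin d₁ → Fin d₀ → ℝ) × (Fin d₂ → Fin d₁ → ℝ)) :
    fderiv ℝ (fun w : (Fin d₁ → Fin d₀ → ℝ) × (Fin d₂ → Fin d₁ → ℝ) =>
      fun (i : Fin d₂) (l : Fin n) => (Matrix.of w.2 * Matrix.of w.1 * Xᵀ) i l) W V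
    = fun i l => (Matrix.of W.2 * Matrix.of V.1 * Xᵀ + Matrix.of V.2 * Matrix.of W.1 * Xᵀ) i l := by
  have hd : DifferentiableAt ℝ (fun w : (Fin d₁ → Fin d₀ → ℝ) × (Fin d₂ → Fin d₁ → ℝ) =>
      fun (i : Fin d₂) (l : Fin n) => (Matrix.of w.2 * Matrix.of w.1 * Xᵀ) i l) W := by
    simp only [Matrix.mul_apply, Matrix.of_apply]
    fun_prop
  rw [← hd.lineDeriv_eq_fderiv]
  apply HasLineDerivAt.lineDeriv
  unfold HasLineDerivAt
  rw [hasDerivAt_pi]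
  intro i
  rw [hasDerivAt_pi]
  intro l
  have key : ∀ t : ℝ, (Matrix.of (W + t • V).2 * Matrix.of (W + t • V).1 * Xᵀ) i l
      = (Matrix.of W.2 * Matrix.of W.1 * Xᵀ) i l
        + t * (Matrix.of W.2 * Matrix.of V.1 * Xᵀ + Matrix.of V.2 * Matrix.of W.1 * Xᵀ) i l
        + t ^ 2 * (Matrix.of V.2 * Matrix.of V.1 * Xᵀ) i l := by
    intro t
    have h2 : Matrix.of (W + t • V).2 = Matrix.of W.2 + t • Matrix.of V.2 := rfl
    have h1 : Matrix.of (W + t • V).1 = Matrix.of W.1 + t • Matrix.of V.1 := rfl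
    rw [h1, h2]
    simp only [Matrix.add_mul, Matrix.mul_add, Matrix.smul_mul, Matrix.mul_smul,
      Matrix.add_apply, Matrix.smul_apply, smul_eq_mul]
    ring
  simp only [key]
  have := (((hasDerivAt_id (0 : ℝ)).mul_const
    ((Matrix.of W.2 * Matrix.of V.1 * Xᵀ + Matrix.of V.2 * Matrix.of W.1 * Xᵀ) i l)).const_add
      ((Matrix.of W.2 * Matrix.of W.1 * Xᵀ) i l)).add
    (((hasDerivAt_id (0 : ℝ)).pow 2).mul_const ((Matrix.of V.2 * Matrix.of V.1 * Xᵀ) i l))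
  refine this.congr_deriv ?_
  simp

lemma frob_aux_single {a b : ℕ} (i : Fin a) (j : Fin b) :
    (Matrix.of (Pi.single i (Pi.single j (1 : ℝ)) : Fin a → Fin b → ℝ))
      = Matrix.single i j (1 : ℝ) := by
  ext x y
  rcases eq_or_ne x i with rfl | hx
  · rcases eq_or_ne y j with rfl | hy
    · simp
    · simp [Matrix.single_apply, hy, hy.symm]
  · simp [Matrix.single_apply, hx, hx.symm]

lemma frob_aux_one {n d₀ d₁ d₂ : ℕ} (X : Matrix (Fin n) (Fin d₀) ℝ)
    (W₂ : Matrix (Fin d₂) (Fin d₁) ℝ) :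
    ∑ i : Fin d₁, ∑ j : Fin d₀, frobSq (W₂ * Matrix.single i j (1 : ℝ) * Xᵀ)
      = frobSq W₂ * frobSq X := by
  have h : ∀ i j, frobSq (W₂ * Matrix.single i j (1 : ℝ) * Xᵀ)
      = (∑ k, W₂ k i ^ 2) * ∑ l, X l j ^ 2 := by
    intro i j
    have e : ∀ k l, (W₂ * Matrix.single i j (1 : ℝ) * Xᵀ) k l = W₂ k i * X l j := by
      intro k l
      simp [Matrix.mul_apply, Matrix.single_apply, ite_and]
    simp only [frobSq, e, mul_pow, Finset.sum_mul_sum]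
  simp only [h, ← Finset.sum_mul_sum]
  unfold frobSq
  rw [Finset.sum_comm, Finset.sum_comm (f := fun l j => X l j ^ 2)]

lemma frob_aux_two {n d₁ d₂ : ℕ} (M : Matrix (Fin d₁) (Fin n) ℝ) :
    ∑ i : Fin d₂, ∑ j : Fin d₁, frobSq (Matrix.single i j (1 : ℝ) * M)
      = (d₂ : ℝ) * frobSq M := by
  have h : ∀ (i : Fin d₂) j, frobSq (Matrix.single i j (1 : ℝ) * M) = ∑ l, M j l ^ 2 := by
    intro i j
    have e : ∀ k l, (Matrix.single i j (1 : ℝ) * M) k l = if i = k then M j l else 0 := by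
      intro k l
      simp [Matrix.mul_apply, Matrix.single_apply, ite_and]
    simp only [frobSq, e]
    rw [Finset.sum_eq_single i]
    · simp
    · intro b _ hb
      simp [hb.symm]
    · simp
  simp only [h]
  simp [frobSq]

/-- For the two-layer linear network `Φ(W₁,W₂) = W₂W₁Xᵀ`, the squared Frobenius norm of the
Jacobian (sum over all coordinate directions of the parameters of the squared Frobenius norm of
the corresponding directional derivative of `Φ`) equals `d₂‖W₁Xᵀ‖_F² + ‖W₂‖_F²‖X‖_F²`;
consequently the effective regularized risk for the square loss is
`R_σ^eff(W₁,W₂) = (1/2n)‖Yᵀ - W₂W₁Xᵀ‖_F² + (σ²/2n)[d₂‖W₁Xᵀ‖_F² + ‖W₂‖_F²‖X‖_F²]`. -/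
theorem linear_network_jacobian_frobenius
    (n d₀ d₁ d₂ : ℕ) (hn : 0 < n)
    (X : Matrix (Fin n) (Fin d₀) ℝ) (Y : Matrix (Fin n) (Fin d₂) ℝ)
    (W₁ : Matrix (Fin d₁) (Fin d₀) ℝ) (W₂ : Matrix (Fin d₂) (Fin d₁) ℝ)
    (Φ : ((Fin d₁ → Fin d₀ → ℝ) × (Fin d₂ → Fin d₁ → ℝ)) → (Fin d₂ → Fin n → ℝ))
    (hΦ : Φ = fun w => fun i l => (Matrix.of w.2 * Matrix.of w.1 * Xᵀ) i l)
    (σ : ℝ) :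
    ((∑ i : Fin d₁, ∑ j : Fin d₀,
        frobSq (Matrix.of (fderiv ℝ Φ (fun a b => W₁ a b, fun a b => W₂ a b)
          ((Pi.single i (Pi.single j (1 : ℝ)) : Fin d₁ → Fin d₀ → ℝ),
           (0 : Fin d₂ → Fin d₁ → ℝ))))) +
      (∑ i : Fin d₂, ∑ j : Fin d₁,
        frobSq (Matrix.of (fderiv ℝ Φ (fun a b => W₁ a b, fun a b => W₂ a b)
          ((0 : Fin d₁ → Fin d₀ → ℝ),
           (Pi.single i (Pi.single j (1 : ℝ)) : Fin d₂ → Fin d₁ → ℝ)))))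
      = (d₂ : ℝ) * frobSq (W₁ * Xᵀ) + frobSq W₂ * frobSq X) ∧
    ((1 / (2 * (n : ℝ))) * frobSq (Yᵀ - W₂ * W₁ * Xᵀ)
        + σ ^ 2 / (2 * (n : ℝ)) *
          (((∑ i : Fin d₁, ∑ j : Fin d₀,
              frobSq (Matrix.of (fderiv ℝ Φ (fun a b => W₁ a b, fun a b => W₂ a b)
                ((Pi.single i (Pi.single j (1 : ℝ)) : Fin d₁ → Fin d₀ → ℝ),
                 (0 : Fin d₂ → Fin d₁ → ℝ))))) +
            (∑ i : Fin d₂, ∑ j : Fin d₁,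
              frobSq (Matrix.of (fderiv ℝ Φ (fun a b => W₁ a b, fun a b => W₂ a b)
                ((0 : Fin d₁ → Fin d₀ → ℝ),
                 (Pi.single i (Pi.single j (1 : ℝ)) : Fin d₂ → Fin d₁ → ℝ)))))))
      = (1 / (2 * (n : ℝ))) * frobSq (Yᵀ - W₂ * W₁ * Xᵀ)
        + σ ^ 2 / (2 * (n : ℝ)) *
          ((d₂ : ℝ) * frobSq (W₁ * Xᵀ) + frobSq W₂ * frobSq X)) := by
  have key : ∀ V, Matrix.of (fderiv ℝ Φ (fun a b => W₁ a b, fun a b => W₂ a b) V)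
      = W₂ * Matrix.of V.1 * Xᵀ + Matrix.of V.2 * W₁ * Xᵀ := by
    intro V
    rw [hΦ, frob_aux_fderiv]
    rfl
  have z1 : Matrix.of (0 : Fin d₁ → Fin d₀ → ℝ) = 0 := rfl
  have z2 : Matrix.of (0 : Fin d₂ → Fin d₁ → ℝ) = 0 := rfl
  simp only [key, frob_aux_single, z1, z2, Matrix.mul_zero, Matrix.zero_mul, add_zero, zero_add]
  have t := frob_aux_two (d₂ := d₂) (W₁ * Xᵀ)
  simp only [← Matrix.mul_assoc] at t
  rw [frob_aux_one, t, add_comm (frobSq W₂ * frobSq X)]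
  exact ⟨rfl, rfl⟩
end

section
/- Let X ∈ ℝ^{n×d₀}, W₁ ∈ ℝ^{d₁×d₀}, W₂ ∈ ℝ^{d₂×d₁}, and let E₁ ∈ ℝ^{d₁×d₀} and E₂ ∈ ℝ^{d₂×d₁} be independent random matrices with i.i.d. standard Gaussian entries. Then for every σ > 0, E[‖(W₂ + σE₂)(W₁ + σE₁)Xᵀ‖_F²] = ‖W₂W₁Xᵀ‖_F² + σ²[‖W₂‖_F²‖X‖_F² + d₂‖W₁Xᵀ‖_F²] + σ⁴ d₁d₂‖X‖_F². -/
open Matrix MeasureTheory ProbabilityTheory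

/-- The law of an `a × b` random matrix with i.i.d. standard Gaussian entries. -/
noncomputable def gaussMatrix (a b : ℕ) : Measure (Fin a → Fin b → ℝ) :=
  Measure.pi fun _ : Fin a => Measure.pi fun _ : Fin b => gaussianReal 0 1


instance gaussMatrix_prob (a b : ℕ) : IsProbabilityMeasure (gaussMatrix a b) := by
  unfold gaussMatrix; infer_instance

lemma mp_row (a b : ℕ) (p : Fin a) : MeasurePreserving (fun E : Fin a → Fin b → ℝ => E p)
    (gaussMatrix a b) (Measure.pi fun _ : Fin b => gaussianReal 0 1) :=
  measurePreserving_eval (fun _ : Fin a => Measure.pi fun _ : Fin b => gaussianReal 0 1) p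

lemma mp_entry (a b : ℕ) (p : Fin a) (q : Fin b) :
    MeasurePreserving (fun E : Fin a → Fin b → ℝ => E p q)
    (gaussMatrix a b) (gaussianReal 0 1) :=
  (measurePreserving_eval (fun _ : Fin b => gaussianReal 0 1) q).comp (mp_row a b p)

lemma memLp_entry (a b : ℕ) (p : Fin a) (q : Fin b) :
    MemLp (fun E : Fin a → Fin b → ℝ => E p q) 2 (gaussMatrix a b) :=
  (memLp_id_gaussianReal (μ := 0) (v := 1) 2).comp_measurePreserving (mp_entry a b p q)

lemma int_entry (a b : ℕ) (p : Fin a) (q : Fin b) :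
    ∫ E, E p q ∂(gaussMatrix a b) = 0 := by
  have h := (mp_entry a b p q)
  have h2 := integral_map (μ := gaussMatrix a b) h.aemeasurable (f := fun x : ℝ => x)
    (by fun_prop)
  rw [h.map_eq, integral_id_gaussianReal] at h2
  exact h2.symm

lemma int_sq_gauss : ∫ x, x * x ∂(gaussianReal 0 1) = 1 := by
  have h := variance_fun_id_gaussianReal (μ := 0) (v := 1)
  rw [variance_eq_integral (by fun_prop)] at h
  simp only [integral_id_gaussianReal, sub_zero, NNReal.coe_one] at h
  simpa [pow_two] using h

lemma int_entry_sq (a b : ℕ) (p : Fin a) (q : Fin b) :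
    ∫ E, E p q * E p q ∂(gaussMatrix a b) = 1 := by
  have h := (mp_entry a b p q)
  have h2 := integral_map (μ := gaussMatrix a b) h.aemeasurable (f := fun x : ℝ => x * x)
    (by fun_prop)
  rw [h.map_eq, int_sq_gauss] at h2
  exact h2.symm

lemma int_entry_ne (a b : ℕ) (p p' : Fin a) (q q' : Fin b) (hne : (p, q) ≠ (p', q')) :
    ∫ E, E p q * E p' q' ∂(gaussMatrix a b) = 0 := by
  by_cases hp : p = p'
  · subst hp
    have hq : q ≠ q' := fun h => hne (by rw [h])
    have h := mp_row a b p
    have h2 := integral_map (μ := gaussMatrix a b) h.aemeasurable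
      (f := fun x : Fin b → ℝ => x q * x q') (by fun_prop)
    rw [← h2, h.map_eq]
    have hi := (iIndepFun_pi (μ := fun _ : Fin b => gaussianReal 0 1) (X := fun _ x => x)
      (fun _ => by fun_prop)).indepFun hq
    rw [hi.integral_fun_mul_eq_mul_integral (Measurable.aestronglyMeasurable (by fun_prop))
      (Measurable.aestronglyMeasurable (by fun_prop))]
    have h3 := integral_map (μ := Measure.pi fun _ : Fin b => gaussianReal 0 1)
      (measurePreserving_eval (fun _ : Fin b => gaussianReal 0 1) q).aemeasurable
      (f := fun x : ℝ => x) (by fun_prop)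
    rw [(measurePreserving_eval (fun _ : Fin b => gaussianReal 0 1) q).map_eq,
      integral_id_gaussianReal] at h3
    have h4 : ∫ x : Fin b → ℝ, x q ∂(Measure.pi fun _ : Fin b => gaussianReal 0 1) = 0 := h3.symm
    rw [h4, zero_mul]
  · have hi := (iIndepFun_pi
      (μ := fun _ : Fin a => Measure.pi fun _ : Fin b => gaussianReal 0 1)
      (X := fun _ x => x) (fun _ => by fun_prop)).indepFun hp
    have hj : IndepFun (fun E : Fin a → Fin b → ℝ => E p q) (fun E => E p' q')
        (gaussMatrix a b) :=
      hi.comp (φ := fun x : Fin b → ℝ => x q) (ψ := fun x : Fin b → ℝ => x q')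
        (by fun_prop) (by fun_prop)
    rw [hj.integral_fun_mul_eq_mul_integral (Measurable.aestronglyMeasurable (by fun_prop))
      (Measurable.aestronglyMeasurable (by fun_prop)), int_entry, zero_mul]

lemma scalar_aff (a b : ℕ) (c : ℝ) (w : Fin a × Fin b → ℝ) :
    Integrable (fun E : Fin a → Fin b → ℝ => (c + ∑ s, w s * E s.1 s.2) ^ 2) (gaussMatrix a b) ∧
    ∫ E, (c + ∑ s, w s * E s.1 s.2) ^ 2 ∂(gaussMatrix a b) = c ^ 2 + ∑ s, w s ^ 2 := by
  have hm : ∀ s : Fin a × Fin b, Integrable (fun E : Fin a → Fin b → ℝ => E s.1 s.2)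
      (gaussMatrix a b) := fun s => (memLp_entry a b s.1 s.2).integrable (by norm_num)
  have hmm : ∀ s t : Fin a × Fin b, Integrable
      (fun E : Fin a → Fin b → ℝ => E s.1 s.2 * E t.1 t.2) (gaussMatrix a b) :=
    fun s t => (memLp_entry a b s.1 s.2).integrable_mul (memLp_entry a b t.1 t.2)
  have hex : (fun E : Fin a → Fin b → ℝ => (c + ∑ s, w s * E s.1 s.2) ^ 2) =
      fun E => (c ^ 2 + ∑ s : Fin a × Fin b, (2 * c * w s) * E s.1 s.2) +
        ∑ s : Fin a × Fin b, ∑ t : Fin a × Fin b, (w s * w t) * (E s.1 s.2 * E t.1 t.2) := by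
    funext E
    have h1 : ∑ s : Fin a × Fin b, ∑ t : Fin a × Fin b, (w s * w t) * (E s.1 s.2 * E t.1 t.2)
        = (∑ s, w s * E s.1 s.2) * (∑ s, w s * E s.1 s.2) := by
      rw [Finset.sum_mul_sum]
      refine Finset.sum_congr rfl fun s _ => Finset.sum_congr rfl fun t _ => by ring
    have h2 : ∑ s : Fin a × Fin b, (2 * c * w s) * E s.1 s.2
        = 2 * c * ∑ s, w s * E s.1 s.2 := by
      rw [Finset.mul_sum]
      refine Finset.sum_congr rfl fun s _ => by ring
    rw [h1, h2]; ring
  have i1 : Integrable (fun E : Fin a → Fin b → ℝ =>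
      ∑ s : Fin a × Fin b, (2 * c * w s) * E s.1 s.2) (gaussMatrix a b) :=
    integrable_finsetSum _ fun s _ => (hm s).const_mul _
  have i2 : ∀ s : Fin a × Fin b, Integrable (fun E : Fin a → Fin b → ℝ =>
      ∑ t : Fin a × Fin b, (w s * w t) * (E s.1 s.2 * E t.1 t.2)) (gaussMatrix a b) :=
    fun s => integrable_finsetSum _ fun t _ => (hmm s t).const_mul _
  have i3 := integrable_finsetSum Finset.univ fun s _ => i2 s
  have i0 : Integrable (fun E : Fin a → Fin b → ℝ =>
      c ^ 2 + ∑ s : Fin a × Fin b, (2 * c * w s) * E s.1 s.2) (gaussMatrix a b) :=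
    (integrable_const (μ := gaussMatrix a b) (c ^ 2)).add i1
  rw [hex]
  refine ⟨i0.add i3, ?_⟩
  rw [integral_add i0 i3, integral_add (integrable_const _) i1,
    integral_finsetSum _ fun s _ => (hm s).const_mul _, integral_finsetSum _ fun s _ => i2 s]
  have e1 : ∀ s : Fin a × Fin b, ∫ E, ∑ t : Fin a × Fin b, (w s * w t) * (E s.1 s.2 * E t.1 t.2)
      ∂(gaussMatrix a b) = w s ^ 2 := by
    intro s
    rw [integral_finsetSum _ fun t _ => (hmm s t).const_mul _, Finset.sum_eq_single s]
    · rw [integral_const_mul, int_entry_sq]; ring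
    · intro t _ ht
      rw [integral_const_mul, int_entry_ne _ _ _ _ _ _ (fun h => ht h.symm), mul_zero]
    · simp
  simp [e1, integral_const_mul, int_entry]

lemma frob_aff (m a b k : ℕ) (M : Matrix (Fin m) (Fin a) ℝ) (A : Matrix (Fin a) (Fin b) ℝ)
    (B : Matrix (Fin b) (Fin k) ℝ) (σ : ℝ) :
    Integrable (fun E : Fin a → Fin b → ℝ => frobSq (M * (A + σ • Matrix.of E) * B))
      (gaussMatrix a b) ∧
    ∫ E, frobSq (M * (A + σ • Matrix.of E) * B) ∂(gaussMatrix a b)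
      = frobSq (M * A * B) + σ ^ 2 * (frobSq M * frobSq B) := by
  have hent : ∀ (E : Fin a → Fin b → ℝ) i j, (M * (A + σ • Matrix.of E) * B) i j
      = (M * A * B) i j + ∑ s : Fin a × Fin b, (σ * (M i s.1 * B s.2 j)) * E s.1 s.2 := by
    intro E i j
    rw [Matrix.mul_add, Matrix.add_mul, Matrix.add_apply]
    congr 1
    rw [Matrix.mul_apply, Fintype.sum_prod_type_right]
    refine Finset.sum_congr rfl fun q _ => ?_
    rw [Matrix.mul_apply, Finset.sum_mul]
    refine Finset.sum_congr rfl fun p _ => ?_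
    simp only [Matrix.smul_apply, Matrix.of_apply, smul_eq_mul]; ring
  have hs := fun i j => scalar_aff a b ((M * A * B) i j) (fun s => σ * (M i s.1 * B s.2 j))
  have i1 := fun i => integrable_finsetSum Finset.univ fun j _ => (hs i j).1
  unfold frobSq
  simp only [hent]
  refine ⟨integrable_finsetSum Finset.univ fun i _ => i1 i, ?_⟩
  rw [integral_finsetSum _ fun i _ => i1 i]
  have e : ∀ i, ∫ E, ∑ j, ((M * A * B) i j
      + ∑ s : Fin a × Fin b, (σ * (M i s.1 * B s.2 j)) * E s.1 s.2) ^ 2 ∂(gaussMatrix a b)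
      = ∑ j, (((M * A * B) i j) ^ 2 + ∑ s : Fin a × Fin b, (σ * (M i s.1 * B s.2 j)) ^ 2) := by
    intro i
    rw [integral_finsetSum _ fun j _ => (hs i j).1]
    exact Finset.sum_congr rfl fun j _ => (hs i j).2
  simp only [e, Finset.sum_add_distrib]
  congr 1
  rw [Finset.sum_mul, Finset.mul_sum]
  refine Finset.sum_congr rfl fun i _ => ?_
  rw [Finset.sum_mul, Finset.mul_sum]
  simp only [Fintype.sum_prod_type]
  rw [Finset.sum_comm]
  refine Finset.sum_congr rfl fun p _ => ?_
  rw [Finset.sum_comm, Finset.mul_sum, Finset.mul_sum]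
  refine Finset.sum_congr rfl fun q _ => ?_
  rw [Finset.mul_sum, Finset.mul_sum]
  refine Finset.sum_congr rfl fun j _ => ?_
  ring

lemma frobSq_one (a : ℕ) : frobSq (1 : Matrix (Fin a) (Fin a) ℝ) = a := by
  simp [frobSq, Matrix.one_apply]

lemma frobSq_transpose {a b : ℕ} (A : Matrix (Fin a) (Fin b) ℝ) : frobSq Aᵀ = frobSq A := by
  unfold frobSq; rw [Finset.sum_comm]; rfl

lemma frobSq_nonneg {a b : ℕ} (A : Matrix (Fin a) (Fin b) ℝ) : 0 ≤ frobSq A := by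
  unfold frobSq; positivity

/-- Exact second moment of the fully perturbed two-layer linear network:
`E‖(W₂+σE₂)(W₁+σE₁)Xᵀ‖_F² = ‖W₂W₁Xᵀ‖_F² + σ²[‖W₂‖_F²‖X‖_F² + d₂‖W₁Xᵀ‖_F²] + σ⁴ d₁d₂‖X‖_F²`,
where `E₁, E₂` are independent with i.i.d. standard Gaussian entries. -/
theorem perturbed_linear_network_second_moment
    (n d₀ d₁ d₂ : ℕ)
    (X : Matrix (Fin n) (Fin d₀) ℝ)
    (W₁ : Matrix (Fin d₁) (Fin d₀) ℝ) (W₂ : Matrix (Fin d₂) (Fin d₁) ℝ)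
    (σ : ℝ) (hσ : 0 < σ) :
    ∫ E, frobSq ((W₂ + σ • Matrix.of E.2) * (W₁ + σ • Matrix.of E.1) * Xᵀ)
        ∂((gaussMatrix d₁ d₀).prod (gaussMatrix d₂ d₁))
      = frobSq (W₂ * W₁ * Xᵀ)
        + σ ^ 2 * (frobSq W₂ * frobSq X + (d₂ : ℝ) * frobSq (W₁ * Xᵀ))
        + σ ^ 4 * (d₁ : ℝ) * (d₂ : ℝ) * frobSq X := by
  have hR : ∀ (B : Matrix (Fin d₁) (Fin n) ℝ),
      Integrable (fun E : Fin d₂ → Fin d₁ → ℝ => frobSq ((W₂ + σ • Matrix.of E) * B))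
        (gaussMatrix d₂ d₁) ∧
      ∫ E, frobSq ((W₂ + σ • Matrix.of E) * B) ∂(gaussMatrix d₂ d₁)
        = frobSq (W₂ * B) + σ ^ 2 * ((d₂ : ℝ) * frobSq B) := by
    intro B
    have h := frob_aff d₂ d₂ d₁ n 1 W₂ B σ
    simpa only [Matrix.one_mul, frobSq_one] using h
  have hL := frob_aff d₂ d₁ d₀ n W₂ W₁ Xᵀ σ
  have hM := frob_aff d₁ d₁ d₀ n 1 W₁ Xᵀ σ
  simp only [Matrix.one_mul, frobSq_one, frobSq_transpose] at hL hM
  have hin : ∀ E₁ : Fin d₁ → Fin d₀ → ℝ,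
      ∫ E₂, frobSq ((W₂ + σ • Matrix.of E₂) * (W₁ + σ • Matrix.of E₁) * Xᵀ) ∂(gaussMatrix d₂ d₁)
      = frobSq (W₂ * (W₁ + σ • Matrix.of E₁) * Xᵀ)
        + σ ^ 2 * ((d₂ : ℝ) * frobSq ((W₁ + σ • Matrix.of E₁) * Xᵀ)) := by
    intro E₁
    simpa only [Matrix.mul_assoc] using (hR ((W₁ + σ • Matrix.of E₁) * Xᵀ)).2
  have hcont : Continuous (fun E : (Fin d₁ → Fin d₀ → ℝ) × (Fin d₂ → Fin d₁ → ℝ) =>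
      frobSq ((W₂ + σ • Matrix.of E.2) * (W₁ + σ • Matrix.of E.1) * Xᵀ)) := by
    unfold frobSq
    simp only [Matrix.mul_apply, Matrix.add_apply, Matrix.smul_apply, Matrix.of_apply]
    fun_prop
  have i2 := (hM.1.const_mul (d₂ : ℝ)).const_mul (σ ^ 2)
  have hint : Integrable (fun E : (Fin d₁ → Fin d₀ → ℝ) × (Fin d₂ → Fin d₁ → ℝ) =>
      frobSq ((W₂ + σ • Matrix.of E.2) * (W₁ + σ • Matrix.of E.1) * Xᵀ))
      ((gaussMatrix d₁ d₀).prod (gaussMatrix d₂ d₁)) := by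
    rw [integrable_prod_iff hcont.aestronglyMeasurable]
    constructor
    · refine Filter.Eventually.of_forall fun E₁ => ?_
      simpa only [Matrix.mul_assoc] using (hR ((W₁ + σ • Matrix.of E₁) * Xᵀ)).1
    · simp only [Real.norm_of_nonneg (frobSq_nonneg _), hin]
      exact hL.1.add i2
  rw [integral_prod _ hint]
  simp only [hin]
  rw [integral_add hL.1 i2, integral_const_mul, integral_const_mul, hL.2, hM.2]
  ring
end

section
/- Let X ∈ ℝ^{n×d₀}, Y ∈ ℝ^{n×d₂}, and define R(W₁,W₂) = (1/2n)‖Yᵀ − W₂W₁Xᵀ‖_F² for W₁ ∈ ℝ^{d₁×d₀}, W₂ ∈ ℝ^{d₂×d₁}. Let E₁ ∈ ℝ^{d₁×d₀}, E₂ ∈ ℝ^{d₂×d₁} be independent random matrices with i.i.d. standard Gaussian entries. Then the layer-wise perturbed risk R̃_σ(W₁,W₂) := (1/2)E[R(W₁ + σ√2 E₁, W₂)] + (1/2)E[R(W₁, W₂ + σ√2 E₂)] satisfies exactly: R̃_σ(W₁,W₂) = R(W₁,W₂) + (σ²/2n)[‖W₂‖_F²‖X‖_F² + d₂‖W₁Xᵀ‖_F²],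 with no higher-order term in σ. -/
open Matrix MeasureTheory ProbabilityTheory

/-- The square-loss risk `R(W₁,W₂) = (1/2n)‖Yᵀ - W₂W₁Xᵀ‖_F²` of the two-layer linear
network. -/
noncomputable def risk (n d₀ d₁ d₂ : ℕ) (X : Matrix (Fin n) (Fin d₀) ℝ)
    (Y : Matrix (Fin n) (Fin d₂) ℝ)
    (W₁ : Matrix (Fin d₁) (Fin d₀) ℝ) (W₂ : Matrix (Fin d₂) (Fin d₁) ℝ) : ℝ :=
  (1 / (2 * (n : ℝ))) * frobSq (Yᵀ - W₂ * W₁ * Xᵀ)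


/-- Sums of independent centred square-integrable coordinates. -/
lemma pi_aux {ι Ω : Type*} [Fintype ι] [MeasurableSpace Ω] (μ : Measure Ω)
    [IsProbabilityMeasure μ] (f : ι → Ω → ℝ) (hf : ∀ i, MemLp (f i) 2 μ)
    (h0 : ∀ i, ∫ x, f i x ∂μ = 0) :
    MemLp (fun ω : ι → Ω => ∑ i, f i (ω i)) 2 (Measure.pi fun _ => μ) ∧
    ∫ ω : ι → Ω, ∑ i, f i (ω i) ∂(Measure.pi fun _ => μ) = 0 ∧
    Var[fun ω : ι → Ω => ∑ i, f i (ω i); Measure.pi fun _ => μ] = ∑ i, Var[f i; μ] := by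
  have hm : ∀ i, MemLp (fun ω : ι → Ω => f i (ω i)) 2 (Measure.pi fun _ => μ) := fun i =>
    (hf i).comp_measurePreserving (measurePreserving_eval (fun _ : ι => μ) i)
  refine ⟨memLp_finsetSum _ fun i _ => hm i, ?_, ?_⟩
  · rw [integral_finsetSum _ fun i _ => (hm i).integrable (by norm_num)]
    refine Finset.sum_eq_zero fun i _ => ?_
    rw [← h0 i]
    exact integral_comp_eval (μ := fun _ : ι => μ) (hf i).aestronglyMeasurable
  · have := variance_sum_pi (μ := fun _ : ι => μ) hf
    rw [← this]
    congr 1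
    ext ω
    simp

instance (a b : ℕ) : IsProbabilityMeasure (gaussMatrix a b) := by
  unfold gaussMatrix; infer_instance

lemma gauss_aux (a b : ℕ) (A : Fin a → Fin b → ℝ) :
    MemLp (fun E => ∑ k, ∑ l, A k l * E k l) 2 (gaussMatrix a b) ∧
    ∫ E, ∑ k, ∑ l, A k l * E k l ∂(gaussMatrix a b) = 0 ∧
    Var[fun E => ∑ k, ∑ l, A k l * E k l; gaussMatrix a b] = ∑ k, ∑ l, A k l ^ 2 := by
  have h1 : ∀ k, _ := fun k => pi_aux (gaussianReal 0 1) (fun l x => A k l * x)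
    (fun l => (memLp_id_gaussianReal 2).const_mul _)
    (fun l => by rw [integral_const_mul, integral_id_gaussianReal, mul_zero])
  have h2 := pi_aux (Measure.pi fun _ : Fin b => gaussianReal 0 1)
    (fun (k : Fin a) (e : Fin b → ℝ) => ∑ l, A k l * e l) (fun k => (h1 k).1)
    (fun k => (h1 k).2.1)
  refine ⟨h2.1, h2.2.1, h2.2.2.trans ?_⟩
  refine Finset.sum_congr rfl fun k _ => (h1 k).2.2.trans ?_
  refine Finset.sum_congr rfl fun l _ => ?_
  have := variance_const_mul (A k l) (fun x : ℝ => x) (gaussianReal 0 1)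
  rw [this, variance_fun_id_gaussianReal]
  simp

lemma sq_aux (a b : ℕ) (A : Fin a → Fin b → ℝ) (c s : ℝ) :
    Integrable (fun E => (c - s * ∑ k, ∑ l, A k l * E k l) ^ 2) (gaussMatrix a b) ∧
    ∫ E, (c - s * ∑ k, ∑ l, A k l * E k l) ^ 2 ∂(gaussMatrix a b)
      = c ^ 2 + s ^ 2 * ∑ k, ∑ l, A k l ^ 2 := by
  obtain ⟨h1, h2, h3⟩ := gauss_aux a b A
  have hL : MemLp (fun E => c - s * ∑ k, ∑ l, A k l * E k l) 2 (gaussMatrix a b) :=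
    (memLp_const c).sub (h1.const_mul s)
  refine ⟨hL.integrable_sq, ?_⟩
  have hi := (h1.integrable (by norm_num)).const_mul s
  have hv := variance_eq_sub hL
  have hm : ∫ E, (c - s * ∑ k, ∑ l, A k l * E k l) ∂(gaussMatrix a b) = c := by
    rw [integral_sub (integrable_const _) hi, integral_const_mul, h2]
    simp
  rw [variance_const_sub hi.aestronglyMeasurable, variance_const_mul, h3, hm] at hv
  have : ∫ E, (c - s * ∑ k, ∑ l, A k l * E k l) ^ 2 ∂(gaussMatrix a b) = 
    (gaussMatrix a b)[(fun E => c - s * ∑ k, ∑ l, A k l * E k l) ^ 2] := rfl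
  rw [this]; linarith

lemma frob_aux (a b p q : ℕ) (A : Fin p → Fin q → Fin a → Fin b → ℝ)
    (C : Matrix (Fin p) (Fin q) ℝ) (s : ℝ)
    (F : (Fin a → Fin b → ℝ) → Matrix (Fin p) (Fin q) ℝ)
    (hF : ∀ E i j, F E i j = C i j - s * ∑ k, ∑ l, A i j k l * E k l) :
    ∫ E, frobSq (F E) ∂(gaussMatrix a b)
      = frobSq C + s ^ 2 * ∑ i, ∑ j, ∑ k, ∑ l, A i j k l ^ 2 := by
  simp only [frobSq, hF]
  have h := fun i j => sq_aux a b (A i j) (C i j) s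
  rw [integral_finsetSum _ fun i _ => integrable_finsetSum _ fun j _ => (h i j).1]
  rw [Finset.mul_sum, ← Finset.sum_add_distrib]
  refine Finset.sum_congr rfl fun i _ => ?_
  rw [Finset.mul_sum, ← Finset.sum_add_distrib]
  rw [integral_finsetSum _ fun j _ => (h i j).1]
  refine Finset.sum_congr rfl fun j _ => ?_
  rw [(h i j).2]

/-- The layer-wise perturbed risk (one of the two layers chosen uniformly at random is
perturbed by `σ√2` times an i.i.d. standard Gaussian matrix) satisfies exactly
`R̃_σ(W₁,W₂) = R(W₁,W₂) + (σ²/2n)[‖W₂‖_F²‖X‖_F² + d₂‖W₁Xᵀ‖_F²]`,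
with no higher-order term in `σ`. -/
theorem layerwise_perturbed_risk_exact
    (n d₀ d₁ d₂ : ℕ) (hn : 0 < n)
    (X : Matrix (Fin n) (Fin d₀) ℝ) (Y : Matrix (Fin n) (Fin d₂) ℝ)
    (W₁ : Matrix (Fin d₁) (Fin d₀) ℝ) (W₂ : Matrix (Fin d₂) (Fin d₁) ℝ)
    (σ : ℝ) (hσ : 0 < σ) :
    (1 / 2) * (∫ E₁, risk n d₀ d₁ d₂ X Y (W₁ + (σ * Real.sqrt 2) • Matrix.of E₁) W₂
        ∂(gaussMatrix d₁ d₀))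
      + (1 / 2) * (∫ E₂, risk n d₀ d₁ d₂ X Y W₁ (W₂ + (σ * Real.sqrt 2) • Matrix.of E₂)
        ∂(gaussMatrix d₂ d₁))
      = risk n d₀ d₁ d₂ X Y W₁ W₂
        + σ ^ 2 / (2 * (n : ℝ)) * (frobSq W₂ * frobSq X + (d₂ : ℝ) * frobSq (W₁ * Xᵀ)) := by
  have e1 : ∫ E₁, risk n d₀ d₁ d₂ X Y (W₁ + (σ * Real.sqrt 2) • Matrix.of E₁) W₂
      ∂(gaussMatrix d₁ d₀) = (1 / (2 * (n : ℝ))) * (frobSq (Yᵀ - W₂ * W₁ * Xᵀ) +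
        (σ * Real.sqrt 2) ^ 2 * (frobSq W₂ * frobSq X)) := by
    simp only [risk]
    rw [integral_const_mul, frob_aux d₁ d₀ d₂ n (fun i j k l => W₂ i k * X j l)
      (Yᵀ - W₂ * W₁ * Xᵀ) (σ * Real.sqrt 2)]
    · congr 3
      simp only [frobSq, mul_pow, Finset.sum_mul_sum]
    · intro E i j
      have : Yᵀ - W₂ * (W₁ + (σ * Real.sqrt 2) • Matrix.of E) * Xᵀ
        = (Yᵀ - W₂ * W₁ * Xᵀ) - (σ * Real.sqrt 2) • (W₂ * (Matrix.of E * Xᵀ)) := by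
        rw [Matrix.mul_add, Matrix.add_mul, Matrix.mul_smul, Matrix.smul_mul, Matrix.mul_assoc,
          Matrix.mul_assoc, sub_add_eq_sub_sub]
      rw [this, Matrix.sub_apply, Matrix.smul_apply, smul_eq_mul]
      congr 2
      simp only [Matrix.mul_apply, Finset.mul_sum, Matrix.of_apply, Matrix.transpose_apply]
      refine Finset.sum_congr rfl fun k _ => Finset.sum_congr rfl fun l _ => ?_
      ring
  have e2 : ∫ E₂, risk n d₀ d₁ d₂ X Y W₁ (W₂ + (σ * Real.sqrt 2) • Matrix.of E₂)
      ∂(gaussMatrix d₂ d₁) = (1 / (2 * (n : ℝ))) * (frobSq (Yᵀ - W₂ * W₁ * Xᵀ) +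
        (σ * Real.sqrt 2) ^ 2 * (d₂ * frobSq (W₁ * Xᵀ))) := by
    simp only [risk]
    rw [integral_const_mul, frob_aux d₂ d₁ d₂ n
      (fun i j k l => if i = k then (W₁ * Xᵀ) l j else 0)
      (Yᵀ - W₂ * W₁ * Xᵀ) (σ * Real.sqrt 2)]
    · congr 3
      have : ∀ (i : Fin d₂) (j : Fin n), ∑ k : Fin d₂, ∑ l,
          (if i = k then (W₁ * Xᵀ) l j else 0) ^ 2 = ∑ l, (W₁ * Xᵀ) l j ^ 2 := by
        intro i j
        rw [Finset.sum_eq_single i]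
        · simp
        · intro k _ hk
          simp [hk.symm]
        · simp
      simp only [this, frobSq, Finset.sum_const, Finset.card_univ, Fintype.card_fin,
        nsmul_eq_mul]
      rw [Finset.sum_comm]
    · intro E i j
      have : Yᵀ - (W₂ + (σ * Real.sqrt 2) • Matrix.of E) * W₁ * Xᵀ
        = (Yᵀ - W₂ * W₁ * Xᵀ) - (σ * Real.sqrt 2) • (Matrix.of E * (W₁ * Xᵀ)) := by
        rw [Matrix.add_mul, Matrix.add_mul, Matrix.smul_mul, Matrix.smul_mul,
          Matrix.mul_assoc (Matrix.of E), sub_add_eq_sub_sub]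
      rw [this, Matrix.sub_apply, Matrix.smul_apply, smul_eq_mul]
      congr 2
      rw [Finset.sum_eq_single i]
      · rw [Matrix.mul_apply]
        simp [mul_comm]
      · intro k _ hk
        simp [hk.symm]
      · simp
  have hs : (σ * Real.sqrt 2) ^ 2 = σ ^ 2 * 2 := by
    rw [mul_pow, Real.sq_sqrt (by norm_num)]
  rw [e1, e2, hs, risk]
  ring
end

section
/- Consider a deep linear network with M layers: W_j ∈ ℝ^{d_j × d_{j−1}} for j = 1,…,M, input data X ∈ ℝ^{n×d₀}, output data Y ∈ ℝ^{n×d_M}, model Φ(W₁,…,W_M) = W_M W_{M−1} ⋯ W₁ Xᵀ, and loss L(φ) = (1/2n)‖Yᵀ − φ‖_F². For each j let E_j ∈ ℝ^{d_j×d_{j−1}} have i.i.d. standard Gaussian entries. Then the layer-wise perturbed risk R̃_σ(W₁,…,W_M) := (1/M) Σ_{j=1}^M E[L(Φ(W₁,…,W_{j−1}, W_j + √M σ E_j, W_{j+1},…,W_M))] satisfies exactly: R̃_σ(W₁,…,W_M) = L(Φ(W₁,…,W_M)) + (σ²/2n) Σ_{j=1}^M ‖W_M ⋯ W_{j+1}‖_F²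 · ‖W_{j−1} ⋯ W₁ Xᵀ‖_F², where for j = M the left factor is ‖I_{d_M}‖_F² = d_M and for j = 1 the right factor is ‖Xᵀ‖_F². -/
open Matrix MeasureTheory ProbabilityTheory

/-- A sum of independent centred square-integrable variables on a product space. -/
lemma pi_sum_moments {ι : Type*} [Fintype ι] {Ω : ι → Type*} {mΩ : ∀ i, MeasurableSpace (Ω i)}
    {μ : (i : ι) → Measure (Ω i)} [∀ i, IsProbabilityMeasure (μ i)]
    {f : ∀ i, Ω i → ℝ} (h : ∀ i, MemLp (f i) 2 (μ i)) (h0 : ∀ i, ∫ x, f i x ∂(μ i) = 0) :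
    MemLp (fun ω => ∑ i, f i (ω i)) 2 (Measure.pi μ) ∧
    ∫ ω, ∑ i, f i (ω i) ∂(Measure.pi μ) = 0 ∧
    Var[fun ω => ∑ i, f i (ω i); Measure.pi μ] = ∑ i, Var[f i; μ i] := by
  have hm : ∀ i, MemLp (fun ω : ∀ i, Ω i => f i (ω i)) 2 (Measure.pi μ) := fun i =>
    (h i).comp_measurePreserving (measurePreserving_eval _ i)
  refine ⟨memLp_finsetSum _ fun i _ => hm i, ?_, ?_⟩
  · rw [integral_finsetSum _ fun i _ => (hm i).integrable (by norm_num)]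
    refine Finset.sum_eq_zero fun i _ => ?_
    rw [integral_comp_eval (μ := μ) (f := f i) (h i).aestronglyMeasurable, h0]
  · rw [← variance_sum_pi h]
    congr 1
    ext ω
    simp

lemma gauss_bilin (a b : ℕ) (u : Fin a → ℝ) (v : Fin b → ℝ) :
    MemLp (fun E : Fin a → Fin b → ℝ => ∑ i, u i * ∑ k, v k * E i k) 2 (gaussMatrix a b) ∧
    ∫ E : Fin a → Fin b → ℝ, ∑ i, u i * ∑ k, v k * E i k ∂(gaussMatrix a b) = 0 ∧
    Var[fun E : Fin a → Fin b → ℝ => ∑ i, u i * ∑ k, v k * E i k; gaussMatrix a b]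
      = (∑ i, u i ^ 2) * ∑ k, v k ^ 2 := by
  have h1 := pi_sum_moments (μ := fun _ : Fin b => gaussianReal 0 1)
    (f := fun k x => v k * x)
    (fun k => (memLp_id_gaussianReal 2).const_mul (v k))
    (fun k => by rw [integral_const_mul, integral_id_gaussianReal, mul_zero])
  obtain ⟨h1a, h1b, h1c⟩ := h1
  have h2 := pi_sum_moments (μ := fun _ : Fin a => Measure.pi fun _ : Fin b => gaussianReal 0 1)
    (f := fun i e => u i * ∑ k, v k * e k)
    (fun i => h1a.const_mul (u i))
    (fun i => by rw [integral_const_mul, h1b, mul_zero])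
  obtain ⟨h2a, h2b, h2c⟩ := h2
  refine ⟨h2a, h2b, h2c.trans ?_⟩
  have h1d : Var[fun e : Fin b → ℝ => ∑ k, v k * e k;
      Measure.pi fun _ : Fin b => gaussianReal 0 1] = ∑ k, v k ^ 2 := by
    refine h1c.trans (Finset.sum_congr rfl fun k _ => ?_)
    rw [variance_const_mul, variance_fun_id_gaussianReal]
    simp
  rw [Finset.sum_mul]
  refine Finset.sum_congr rfl fun i _ => ?_
  rw [variance_const_mul, h1d]

lemma sq_affine {Ω : Type*} [MeasurableSpace Ω] {μ : Measure Ω} [IsProbabilityMeasure μ]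
    {S : Ω → ℝ} (h : MemLp S 2 μ) (h0 : ∫ x, S x ∂μ = 0) (c s : ℝ) :
    Integrable (fun x => (c - s * S x) ^ 2) μ ∧
    ∫ x, (c - s * S x) ^ 2 ∂μ = c ^ 2 + s ^ 2 * Var[S; μ] := by
  have hi : Integrable S μ := h.integrable (by norm_num)
  have hs : Integrable (fun x => S x ^ 2) μ := h.integrable_sq
  have he : (fun x => (c - s * S x) ^ 2) =
      fun x => (c ^ 2 - (2 * c * s) * S x) + s ^ 2 * S x ^ 2 := by
    ext x; ring
  have i1 : Integrable (fun x => c ^ 2 - (2 * c * s) * S x) μ :=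
    (integrable_const _).sub (hi.const_mul _)
  rw [he]
  refine ⟨i1.add (hs.const_mul _), ?_⟩
  rw [integral_add i1 (hs.const_mul _), integral_sub (integrable_const _) (hi.const_mul _),
    integral_const_mul, integral_const_mul, h0,
    variance_of_integral_eq_zero h.aestronglyMeasurable.aemeasurable h0]
  simp

lemma frob_expect {p a b q : ℕ} (D : Matrix (Fin p) (Fin q) ℝ) (A : Matrix (Fin p) (Fin a) ℝ)
    (C : Matrix (Fin b) (Fin q) ℝ) (s : ℝ) :
    ∫ E, frobSq (D - s • (A * Matrix.of E * C)) ∂(gaussMatrix a b)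
      = frobSq D + s ^ 2 * (frobSq A * frobSq C) := by
  have key : ∀ (E : Fin a → Fin b → ℝ) i j, (D - s • (A * Matrix.of E * C)) i j
      = D i j - s * ∑ k, A i k * ∑ l, C l j * E k l := by
    intro E i j
    rw [Matrix.mul_assoc]
    simp [Matrix.mul_apply, mul_comm]
  have hq := fun i j => sq_affine (gauss_bilin a b (A i) (fun l => C l j)).1
    (gauss_bilin a b (A i) (fun l => C l j)).2.1 (D i j) s
  simp only [frobSq, key]
  rw [integral_finsetSum _ fun i _ => integrable_finsetSum _ fun j _ => (hq i j).1]
  simp_rw [integral_finsetSum _ fun j _ => (hq _ j).1, (hq _ _).2,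
    (gauss_bilin a b _ _).2.2, Finset.sum_add_distrib]
  congr 1
  simp_rw [← Finset.mul_sum]
  rw [← Finset.sum_mul, Finset.sum_comm (f := fun (j : Fin b) (k : Fin q) => C j k ^ 2)]

/-- For a deep linear network `Φ(W₁,…,W_M) = W_M ⋯ W₁ Xᵀ` with square loss
`L(φ) = (1/2n)‖Yᵀ - φ‖_F²`, the layer-wise perturbed risk (a layer `j` chosen uniformly at
random is perturbed by `√M σ` times an i.i.d. standard Gaussian matrix) satisfies exactly
`R̃_σ = L(Φ) + (σ²/2n) ∑_j ‖W_M ⋯ W_{j+1}‖_F² ‖W_{j-1} ⋯ W₁ Xᵀ‖_F²`.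
Here the layers are indexed `W 0, …, W (M-1)` (Lean index `j` is paper layer `j+1`),
`B j = W_{j} ⋯ W_1` (paper indexing) is the lower partial product, pinned down by
`B 0 = 1`, `B (j+1) = W j * B j`, and `A j = W_M ⋯ W_{j+1}` (paper indexing) is the upper
partial product, pinned down by `A M = 1`, `A j = A (j+1) * W j` for `j < M`; in particular
the empty products are identity matrices, so for the top layer the left factor is
`‖1‖_F² = d_M` and for the bottom layer the right factor is `‖Xᵀ‖_F²`. -/
theorem deep_linear_layerwise_perturbed_risk
    (M : ℕ) (hM : 0 < M) (d : ℕ → ℕ) (n : ℕ) (hn : 0 < n)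
    (W : ∀ j : ℕ, Matrix (Fin (d (j + 1))) (Fin (d j)) ℝ)
    (X : Matrix (Fin n) (Fin (d 0)) ℝ) (Y : Matrix (Fin n) (Fin (d M)) ℝ)
    (A : ∀ j : ℕ, Matrix (Fin (d M)) (Fin (d j)) ℝ)
    (B : ∀ j : ℕ, Matrix (Fin (d j)) (Fin (d 0)) ℝ)
    (hAM : A M = 1) (hA : ∀ j < M, A j = A (j + 1) * W j)
    (hB0 : B 0 = 1) (hB : ∀ j, B (j + 1) = W j * B j)
    (σ : ℝ) (hσ : 0 < σ) :
    (1 / (M : ℝ)) * ∑ j ∈ Finset.range M,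
        ∫ E, (1 / (2 * (n : ℝ))) *
            frobSq (Yᵀ - A (j + 1) * (W j + (Real.sqrt M * σ) • Matrix.of E) * (B j * Xᵀ))
          ∂(gaussMatrix (d (j + 1)) (d j))
      = (1 / (2 * (n : ℝ))) * frobSq (Yᵀ - B M * Xᵀ)
        + σ ^ 2 / (2 * (n : ℝ)) *
            ∑ j ∈ Finset.range M, frobSq (A (j + 1)) * frobSq (B j * Xᵀ) := by
  have hAB : ∀ k, k ≤ M → A (M - k) * B (M - k) = B M := by
    intro k
    induction k with
    | zero => intro _; simp [hAM]
    | succ k ih =>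
      intro hk
      rw [← ih (by omega)]
      have e : M - k = (M - (k + 1)) + 1 := by omega
      rw [e, hB, hA (M - (k + 1)) (by omega), Matrix.mul_assoc]
  have hterm : ∀ j ∈ Finset.range M,
      ∫ E, (1 / (2 * (n : ℝ))) *
          frobSq (Yᵀ - A (j + 1) * (W j + (Real.sqrt M * σ) • Matrix.of E) * (B j * Xᵀ))
        ∂(gaussMatrix (d (j + 1)) (d j))
      = (1 / (2 * (n : ℝ))) * (frobSq (Yᵀ - B M * Xᵀ)
          + M * σ ^ 2 * (frobSq (A (j + 1)) * frobSq (B j * Xᵀ))) := by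
    intro j hj
    have hj' := Finset.mem_range.1 hj
    have hABj : A (j + 1) * W j * (B j * Xᵀ) = B M * Xᵀ := by
      have := hAB (M - j) (by omega)
      rw [show M - (M - j) = j by omega] at this
      rw [← hA j hj', ← Matrix.mul_assoc, this]
    have hE : ∀ E : Fin (d (j + 1)) → Fin (d j) → ℝ,
        Yᵀ - A (j + 1) * (W j + (Real.sqrt M * σ) • Matrix.of E) * (B j * Xᵀ)
        = (Yᵀ - B M * Xᵀ) - (Real.sqrt M * σ) • (A (j + 1) * Matrix.of E * (B j * Xᵀ)) := by
      intro E
      rw [Matrix.mul_add, Matrix.add_mul, hABj, Matrix.mul_smul, Matrix.smul_mul, sub_sub]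
    simp_rw [hE]
    rw [integral_const_mul, frob_expect, mul_pow, Real.sq_sqrt (Nat.cast_nonneg M)]
  rw [Finset.sum_congr rfl hterm, ← Finset.mul_sum, Finset.sum_add_distrib, ← Finset.mul_sum]
  have hM' : (M : ℝ) ≠ 0 := by exact_mod_cast hM.ne'
  have hn' : (n : ℝ) ≠ 0 := by exact_mod_cast hn.ne'
  simp only [Finset.sum_const, Finset.card_range, nsmul_eq_mul]
  field_simp
end
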